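/- The doubly shifted Hankel determinant of the Carlitz q-Euler numbers satisfies det_{0≤i,j≤n}(ε_{i+j+2}) = (−1)^{binom(n+2,2)} q^{(1/4)·binom(2n+4,3)} (1+q)^n (1 − (−1)^n q^{(n+2)^2}) / ((1−q)^{n(n+1)} (1+q^2)^{2(n+1)} (1+q^3)^{n+1}) · Π_{k=1}^n (q^4;q^2)_k (q^4;q^2)_k / ((−q^3;q^2)_k (−q^4;q^2)_k (−q^4;q^2)_k (−q^5;q^2)_k). -/

import Mathlib

open Finset

noncomputable def q : RatFunc ℚ := RatFunc.X

/-- q-Pochhammer `(A;Q)_n`. -/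
noncomputable def qPoch (Q A : RatFunc ℚ) (n : ℕ) : RatFunc ℚ :=
  ∏ j ∈ Finset.range n, (1 - A * Q ^ j)

section Determinants

variable {K : Type*} [Field K]

/-- Pivoting on the last entry relates two consecutive Cauchy determinants. -/
theorem det_cauchy_succ (x y : ℕ → K) (h : ∀ i j, 1 + x i * y j ≠ 0) (m : ℕ) :
    Matrix.det (Matrix.of fun i j : Fin (m + 1) => (1 + x i * y j)⁻¹) =
      (1 + x m * y m)⁻¹ *
        (∏ i ∈ range m, (x i - x m) * (y m - y i) / ((1 + x i * y m) * (1 + x m * y i))) *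
        Matrix.det (Matrix.of fun i j : Fin m => (1 + x i * y j)⁻¹) := by
  set c : Fin (m + 1) → K :=
    fun i => if i = Fin.last m then 0 else (1 + x m * y m) / (1 + x i * y m) with hc
  set A : Matrix (Fin (m + 1)) (Fin (m + 1)) K :=
    Matrix.of fun i j => (1 + x i * y j)⁻¹ with hA
  set B : Matrix (Fin (m + 1)) (Fin (m + 1)) K :=
    Matrix.of fun i j => A i j - c i * A (Fin.last m) j with hB
  have hAB : A.det = B.det :=
    Matrix.det_eq_of_forall_row_eq_smul_add_const c (Fin.last m) (by simp [hc])
      (fun i j => by simp [hB, hc])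
  have hcol (i : Fin m) : B i.castSucc (Fin.last m) = 0 := by
    simp only [hB, hA, hc, Matrix.of_apply, Fin.castSucc_ne_last, if_false, Fin.val_castSucc,
      Fin.val_last]
    rw [div_mul_eq_mul_div, mul_inv_cancel₀ (h m m), one_div, sub_self]
  have hlast : B (Fin.last m) (Fin.last m) = (1 + x m * y m)⁻¹ := by
    simp [hB, hA, hc]
  have hminor : B.submatrix Fin.castSucc Fin.castSucc =
      Matrix.of fun i j : Fin m => ((x i - x m) / (1 + x i * y m)) *
        (Matrix.of fun i j : Fin m => ((y m - y j) / (1 + x m * y j)) *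
          (Matrix.of fun i j : Fin m => (1 + x i * y j)⁻¹) i j) i j := by
    ext i j
    have h₁ := h i m
    have h₂ := h m j
    have h₂' : 1 + y j * x m ≠ 0 := mul_comm (x m) (y j) ▸ h₂
    have h₃ := h i j
    simp only [hB, hA, hc, Matrix.of_apply, Fin.castSucc_ne_last, if_false, Fin.val_castSucc,
      Fin.val_last, Matrix.submatrix_apply]
    field_simp
    ring
  rw [hAB, Matrix.det_succ_column B (Fin.last m), Fin.sum_univ_castSucc]
  simp only [hcol, hlast, mul_zero, zero_mul, sum_const_zero, zero_add, Fin.succAbove_last,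
    hminor, Matrix.det_mul_column, Matrix.det_mul_row, Fin.val_last]
  rw [Even.neg_one_pow ⟨m, rfl⟩, one_mul, Fin.prod_univ_eq_prod_range
    (fun i => (x i - x m) / (1 + x i * y m)), Fin.prod_univ_eq_prod_range
    (fun i => (y m - y i) / (1 + x m * y i)), mul_assoc, ← mul_assoc (∏ i ∈ range m, _),
    ← prod_mul_distrib]
  simp only [div_mul_div_comm]

/-- Perturbing the top left entry changes the determinant by a multiple of the minor. -/
theorem det_sub_single_zero (m : ℕ) (H : Matrix (Fin (m + 1)) (Fin (m + 1)) K) (s : K) :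
    (H - Matrix.of fun i j => if i = 0 ∧ j = 0 then s else 0).det =
      H.det - s * (H.submatrix Fin.succ Fin.succ).det := by
  have hsub (j : Fin (m + 1)) :
      (H - Matrix.of fun i j => if i = 0 ∧ j = 0 then s else 0).submatrix Fin.succ j.succAbove =
        H.submatrix Fin.succ j.succAbove := by
    ext i k
    simp
  rw [Matrix.det_succ_row_zero, Matrix.det_succ_row_zero H]
  simp only [hsub]
  rw [Fin.sum_univ_succ, Fin.sum_univ_succ]
  simp
  ring

end Determinants

section Moments

open Polynomial

variable {K : Type*} [Field K]

/-- The linear functional with prescribed moments. -/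
noncomputable def momentFunctional (ε : ℕ → K) : K[X] →ₗ[K] K :=
  Polynomial.lsum fun n => ε n • LinearMap.id

@[simp]
theorem momentFunctional_monomial (ε : ℕ → K) (n : ℕ) (a : K) :
    momentFunctional ε (monomial n a) = ε n * a := by
  simp [momentFunctional, Polynomial.lsum_apply, Polynomial.sum_monomial_index]

theorem momentFunctional_X_pow (ε : ℕ → K) (n : ℕ) : momentFunctional ε (X ^ n) = ε n := by
  rw [← monomial_one_right_eq_X_pow, momentFunctional_monomial, mul_one]

/-- The defining recurrence of the `z`-Euler numbers as a functional equation. -/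
theorem momentFunctional_comp (z : K) (ε : ℕ → K) (h0 : ε 0 = 1)
    (hrec : ∀ n : ℕ, 1 ≤ n →
      (∑ k ∈ range (n + 1), (n.choose k : K) * z ^ (k + 1) * ε k) + ε n = 0) (p : K[X]) :
    z * momentFunctional ε (p.comp (C z * X + 1)) + momentFunctional ε p =
      (1 + z) * p.eval 0 := by
  induction p using Polynomial.induction_on' with
  | add p r hp hr =>
    simp only [add_comp, map_add, eval_add]
    linear_combination hp + hr
  | monomial n a =>
    have hexp : z * momentFunctional ε ((C z * X + 1) ^ n) =
        ∑ k ∈ range (n + 1), (n.choose k : K) * z ^ (k + 1) * ε k := by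
      rw [add_pow, map_sum, mul_sum]
      refine sum_congr rfl fun k _ => ?_
      have : (C z * X) ^ k * 1 ^ (n - k) * (n.choose k : K[X]) =
          monomial k (z ^ k * (n.choose k : K)) := by
        rw [← C_mul_X_pow_eq_monomial, mul_pow, C_mul, C_pow, one_pow, map_natCast]
        ring
      rw [this, momentFunctional_monomial]
      ring
    have hcomp : (monomial n a).comp (C z * X + 1) = a • (C z * X + 1) ^ n := by
      rw [monomial_comp, smul_eq_C_mul]
    rw [hcomp, map_smul, smul_eq_mul, mul_left_comm, hexp, momentFunctional_monomial]
    rcases Nat.eq_zero_or_pos n with rfl | hn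
    · simp [h0]
      ring
    · rw [eval_monomial, zero_pow hn.ne']
      linear_combination a * hrec n hn

/-- The moments in the variable `1 - (1 - z) X`. -/
theorem momentFunctional_linear_pow (z : K) (ε : ℕ → K) (h0 : ε 0 = 1)
    (hrec : ∀ n : ℕ, 1 ≤ n →
      (∑ k ∈ range (n + 1), (n.choose k : K) * z ^ (k + 1) * ε k) + ε n = 0)
    (k : ℕ) (hk : 1 + z ^ (k + 1) ≠ 0) :
    momentFunctional ε ((1 - C (1 - z) * X) ^ k) = (1 + z) * (1 + z ^ (k + 1))⁻¹ := by
  have h := momentFunctional_comp z ε h0 hrec ((1 - C (1 - z) * X) ^ k)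
  have hcomp : ((1 - C (1 - z) * X) ^ k).comp (C z * X + 1) =
      z ^ k • (1 - C (1 - z) * X) ^ k := by
    rw [smul_eq_C_mul, C_pow, ← mul_pow]
    simp only [pow_comp, sub_comp, one_comp, mul_comp, C_comp, X_comp, C_sub, C_1]
    ring
  rw [hcomp, map_smul, smul_eq_mul] at h
  rw [eq_mul_inv_iff_mul_eq₀ hk]
  simp only [eval_pow, eval_sub, eval_one, eval_mul, eval_C, eval_X, mul_zero, sub_zero,
    one_pow] at h
  linear_combination h

/-- The triangular matrix of coefficients of the powers of `1 - (1 - z) X`. -/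
noncomputable def linearPowCoeff (z : K) (m : ℕ) : Matrix (Fin m) (Fin m) K :=
  Matrix.of fun i j => ((1 - C (1 - z) * X : K[X]) ^ (i : ℕ)).coeff j

theorem coeff_linear_pow (z : K) (i j : ℕ) :
    ((1 - C (1 - z) * X : K[X]) ^ i).coeff j = (i.choose j : K) * (-(1 - z)) ^ j := by
  have h : (1 - C (1 - z) * X : K[X]) ^ i = ((1 + X) ^ i).comp (C (-(1 - z)) * X) := by
    simp only [pow_comp, add_comp, one_comp, X_comp, C_neg, neg_mul, sub_eq_add_neg]
  rw [h, comp_C_mul_X_coeff, coeff_one_add_X_pow]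

theorem det_linearPowCoeff (z : K) (m : ℕ) :
    (linearPowCoeff z m).det = ∏ i ∈ range m, (-(1 - z)) ^ i := by
  rw [Matrix.det_of_isLowerTriangular, ← Fin.prod_univ_eq_prod_range]
  · simp only [linearPowCoeff, Matrix.of_apply, coeff_linear_pow, Nat.choose_self, Nat.cast_one,
      one_mul]
  · intro i j hij
    have hij' : (i : ℕ) < j := hij
    rw [linearPowCoeff, Matrix.of_apply, coeff_linear_pow, Nat.choose_eq_zero_of_lt hij',
      Nat.cast_zero, zero_mul]

theorem linear_pow_eq_sum (z : K) {m : ℕ} (i : Fin m) :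
    (1 - C (1 - z) * X : K[X]) ^ (i : ℕ) =
      ∑ k : Fin m, linearPowCoeff z m i k • (X : K[X]) ^ (k : ℕ) := by
  have hdeg : ((1 - C (1 - z) * X : K[X]) ^ (i : ℕ)).natDegree < m := by
    refine lt_of_le_of_lt (natDegree_pow_le_of_le (i : ℕ) (m := 1) ?_) (by simp)
    compute_degree
  conv_lhs => rw [as_sum_range' _ m hdeg]
  rw [← Fin.sum_univ_eq_sum_range
    (fun k => monomial k (((1 - C (1 - z) * X : K[X]) ^ (i : ℕ)).coeff k))]
  refine sum_congr rfl fun k _ => ?_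
  rw [linearPowCoeff, Matrix.of_apply, smul_eq_C_mul, C_mul_X_pow_eq_monomial]

theorem linearPowCoeff_mul_hankel (z : K) (ε : ℕ → K) (m : ℕ) :
    linearPowCoeff z m * (Matrix.of fun i j : Fin m => ε (i + j)) * (linearPowCoeff z m).transpose =
      Matrix.of fun i j : Fin m =>
        momentFunctional ε ((1 - C (1 - z) * X) ^ ((i : ℕ) + (j : ℕ))) := by
  ext i j
  rw [Matrix.of_apply, pow_add, linear_pow_eq_sum z i, linear_pow_eq_sum z j, Finset.sum_mul_sum,
    map_sum, Matrix.mul_apply]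
  simp only [Matrix.mul_apply, Matrix.transpose_apply, Finset.sum_mul, map_sum,
    smul_mul_smul_comm, ← pow_add, map_smul, momentFunctional_X_pow, Matrix.of_apply, smul_eq_mul]
  rw [sum_comm]
  refine sum_congr rfl fun k _ => sum_congr rfl fun l _ => ?_
  ring

theorem linearPowCoeff_mul_single (z s : K) (m : ℕ) :
    linearPowCoeff z (m + 1) * (Matrix.of fun i j => if i = 0 ∧ j = 0 then s else 0) *
      (linearPowCoeff z (m + 1)).transpose = Matrix.of fun _ _ => s := by
  ext i j
  have hcol (i : Fin (m + 1)) : linearPowCoeff z (m + 1) i 0 = 1 := by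
    simp [linearPowCoeff, coeff_zero_eq_eval_zero]
  simp [Matrix.mul_apply, hcol, ite_and]

/-- The Hankel determinant in terms of the Cauchy determinant. -/
theorem det_hankel_eq_cauchy (z : K) (hz : ∀ k : ℕ, 1 + z ^ k ≠ 0) (ε : ℕ → K) (h0 : ε 0 = 1)
    (hrec : ∀ n : ℕ, 1 ≤ n →
      (∑ k ∈ range (n + 1), (n.choose k : K) * z ^ (k + 1) * ε k) + ε n = 0) (m : ℕ) :
    (∏ i ∈ range m, (-(1 - z)) ^ i) ^ 2 * Matrix.det (Matrix.of fun i j : Fin m => ε (i + j)) =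
      (1 + z) ^ m *
        Matrix.det (Matrix.of fun i j : Fin m => (1 + z ^ (i : ℕ) * z ^ ((j : ℕ) + 1))⁻¹) := by
  have h := congrArg Matrix.det (linearPowCoeff_mul_hankel z ε m)
  simp only [momentFunctional_linear_pow z ε h0 hrec _ (hz _)] at h
  rw [Matrix.det_mul, Matrix.det_mul, Matrix.det_transpose, det_linearPowCoeff] at h
  have hR := Matrix.det_smul
    (Matrix.of fun i j : Fin m => (1 + z ^ (i : ℕ) * z ^ ((j : ℕ) + 1))⁻¹) (1 + z)
  rw [Fintype.card_fin] at hR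
  rw [← hR, sq, mul_right_comm, h]
  congr 1
  ext i j
  simp [← pow_add, add_assoc]

/-- The doubly shifted Hankel determinant in terms of the unshifted one. -/
theorem det_hankel_shift_two (z : K) (hz : ∀ k : ℕ, 1 + z ^ k ≠ 0) (hz1 : 1 - z ≠ 0)
    (ε : ℕ → K) (h0 : ε 0 = 1)
    (hrec : ∀ n : ℕ, 1 ≤ n →
      (∑ k ∈ range (n + 1), (n.choose k : K) * z ^ (k + 1) * ε k) + ε n = 0) (m : ℕ) :
    (1 + z) * Matrix.det (Matrix.of fun i j : Fin m => ε (i + j + 2)) =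
      (1 - (-1) ^ (m + 1) * z ^ ((m + 1) ^ 2)) *
        Matrix.det (Matrix.of fun i j : Fin (m + 1) => ε (i + j)) := by
  set H : Matrix (Fin (m + 1)) (Fin (m + 1)) K := Matrix.of fun i j => ε (i + j) with hH
  set E : Matrix (Fin (m + 1)) (Fin (m + 1)) K :=
    Matrix.of fun i j => if i = 0 ∧ j = 0 then 1 + z else 0 with hE
  set Γ : Matrix (Fin (m + 1)) (Fin (m + 1)) K :=
    Matrix.of fun i j => (1 + z ^ (i : ℕ) * z ^ ((j : ℕ) + 1))⁻¹ with hΓ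
  have hminor : H.submatrix Fin.succ Fin.succ = Matrix.of fun i j : Fin m => ε (i + j + 2) := by
    ext i j
    simp only [hH, Matrix.submatrix_apply, Matrix.of_apply, Fin.val_succ]
    congr 1
    ring
  have hdiff : linearPowCoeff z (m + 1) * (H - E) * (linearPowCoeff z (m + 1)).transpose =
      (1 + z) • Matrix.of fun i j : Fin (m + 1) => (-z ^ (i : ℕ)) *
        (Matrix.of fun i j : Fin (m + 1) => z ^ ((j : ℕ) + 1) * Γ i j) i j := by
    rw [mul_sub, sub_mul, linearPowCoeff_mul_hankel, linearPowCoeff_mul_single]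
    ext i j
    have hij := hz (i + j + 1)
    simp only [momentFunctional_linear_pow z ε h0 hrec _ (hz _), Matrix.sub_apply,
      Matrix.smul_apply, Matrix.of_apply, smul_eq_mul, hΓ]
    rw [← pow_add, ← add_assoc]
    field_simp
    ring
  have hdet := congrArg Matrix.det hdiff
  rw [Matrix.det_mul, Matrix.det_mul, Matrix.det_transpose, det_linearPowCoeff, Matrix.det_smul,
    Fintype.card_fin, Matrix.det_mul_column, Matrix.det_mul_row, det_sub_single_zero, hminor,
    Fin.prod_univ_eq_prod_range (fun i => -z ^ i), Fin.prod_univ_eq_prod_range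
    (fun i => z ^ (i + 1))] at hdet
  have hscale : (∏ i ∈ range (m + 1), -z ^ i) * ∏ i ∈ range (m + 1), z ^ (i + 1) =
      (-1) ^ (m + 1) * z ^ ((m + 1) ^ 2) := by
    rw [← prod_mul_distrib]
    induction m + 1 with
    | zero => simp
    | succ k ih =>
      rw [prod_range_succ, ih]
      ring
  have hP : (∏ i ∈ range (m + 1), (-(1 - z)) ^ i) ≠ 0 :=
    prod_ne_zero_iff.2 fun i _ => pow_ne_zero _ (neg_ne_zero.2 hz1)
  have hH' := det_hankel_eq_cauchy z hz ε h0 hrec (m + 1)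
  apply mul_left_cancel₀ (pow_ne_zero 2 hP)
  rw [← hH, ← hΓ] at hH'
  linear_combination ((-1) ^ (m + 1) * z ^ ((m + 1) ^ 2)) * hH' - hdet -
    (1 + z) ^ (m + 1) * Γ.det * hscale

/-- The ratio of consecutive Hankel determinants. -/
theorem det_hankel_succ (z : K) (hz : ∀ k : ℕ, 1 + z ^ k ≠ 0) (hz1 : 1 - z ≠ 0)
    (ε : ℕ → K) (h0 : ε 0 = 1)
    (hrec : ∀ n : ℕ, 1 ≤ n →
      (∑ k ∈ range (n + 1), (n.choose k : K) * z ^ (k + 1) * ε k) + ε n = 0) (m : ℕ) :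
    Matrix.det (Matrix.of fun i j : Fin (m + 1) => ε (i + j)) =
      (1 + z) * (-1) ^ m * z ^ (m ^ 2) *
        ((∏ i ∈ range m, (1 - z ^ (i + 1))) * ∏ i ∈ range m, (1 + z ^ (i + 1))) ^ 2 /
        ((1 - z) ^ (2 * m) * (∏ i ∈ range (2 * m), (1 + z ^ (i + 1))) *
          ∏ i ∈ range (2 * m + 1), (1 + z ^ (i + 1))) *
        Matrix.det (Matrix.of fun i j : Fin m => ε (i + j)) := by
  have hprod (n : ℕ) : (∏ i ∈ range n, (1 + z ^ (i + 1))) ≠ 0 :=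
    prod_ne_zero_iff.2 fun i _ => hz _
  have hP : (∏ i ∈ range m, (-(1 - z)) ^ i) ≠ 0 :=
    prod_ne_zero_iff.2 fun i _ => pow_ne_zero _ (neg_ne_zero.2 hz1)
  have hcauchy := det_cauchy_succ (fun i => z ^ i) (fun i => z ^ (i + 1))
    (fun i j => by rw [← pow_add]; exact hz _) m
  have hnum : ∏ i ∈ range m, (z ^ i - z ^ m) * (z ^ (m + 1) - z ^ (i + 1)) =
      (-1) ^ m * z ^ (m ^ 2) * (∏ i ∈ range m, (1 - z ^ (i + 1))) ^ 2 := by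
    have hterm : ∀ i ∈ range m, (z ^ i - z ^ m) * (z ^ (m + 1) - z ^ (i + 1)) =
        -z ^ (2 * i + 1) * (1 - z ^ (m - 1 - i + 1)) ^ 2 := by
      intro i hi
      obtain ⟨d, rfl⟩ : ∃ d, m = i + d + 1 := ⟨m - 1 - i, by have := mem_range.1 hi; omega⟩
      rw [show i + d + 1 - 1 - i = d by omega]
      ring
    rw [prod_congr rfl hterm, prod_mul_distrib, prod_pow,
      prod_range_reflect (fun i => 1 - z ^ (i + 1))]
    congr 1
    clear hP hcauchy hterm
    induction m with
    | zero => simp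
    | succ k ih =>
      rw [prod_range_succ, ih]
      ring
  have hden : (∏ i ∈ range m, (1 + z ^ i * z ^ (m + 1)) * (1 + z ^ m * z ^ (i + 1))) *
      (∏ i ∈ range m, (1 + z ^ (i + 1))) ^ 2 = (∏ i ∈ range (2 * m), (1 + z ^ (i + 1))) ^ 2 := by
    rw [two_mul, prod_range_add, mul_pow, mul_comm,
      ← prod_pow (range m) 2 fun i => 1 + z ^ (m + i + 1)]
    congr 1
    refine prod_congr rfl fun i _ => ?_
    ring
  have hden0 : (∏ i ∈ range m, (1 + z ^ i * z ^ (m + 1)) * (1 + z ^ m * z ^ (i + 1))) ≠ 0 := by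
    intro h
    rw [h, zero_mul] at hden
    exact pow_ne_zero 2 (hprod _) hden.symm
  have hm := det_hankel_eq_cauchy z hz ε h0 hrec m
  have hm' := det_hankel_eq_cauchy z hz ε h0 hrec (m + 1)
  rw [hcauchy, prod_div_distrib, hnum, prod_range_succ] at hm'
  rw [prod_range_succ _ (2 * m)]
  have hlast : 1 + z ^ m * z ^ (m + 1) = 1 + z ^ (2 * m + 1) := by ring
  rw [hlast] at hm'
  have h2 := hz (2 * m + 1)
  have hsq : ((-(1 - z)) ^ m) ^ 2 = (1 - z) ^ (2 * m) := by
    rw [← pow_mul, mul_comm m 2, pow_mul, pow_mul, neg_sq]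
  rw [mul_pow, hsq] at hm'
  apply mul_left_cancel₀ (mul_ne_zero (pow_ne_zero 2 hP) (pow_ne_zero (2 * m) hz1))
  rw [hm']
  have h3 := hprod (2 * m)
  generalize Matrix.det (Matrix.of fun i j : Fin (m + 1) => ε (i + j)) = D' at *
  generalize Matrix.det (Matrix.of fun i j : Fin m => ε (i + j)) = D at *
  generalize Matrix.det (Matrix.of fun i j : Fin m =>
    (1 + z ^ (i : ℕ) * z ^ ((j : ℕ) + 1))⁻¹) = Δ at *
  generalize (∏ i ∈ range m, (1 + z ^ i * z ^ (m + 1)) * (1 + z ^ m * z ^ (i + 1))) = W at *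
  generalize (∏ i ∈ range m, (-(1 - z)) ^ i) = P at *
  generalize (∏ i ∈ range m, (1 - z ^ (i + 1))) = S at *
  generalize (∏ i ∈ range m, (1 + z ^ (i + 1))) = T at *
  generalize (∏ i ∈ range (2 * m), (1 + z ^ (i + 1))) = U at *
  generalize 1 + z ^ (2 * m + 1) = V at *
  generalize z ^ (m ^ 2) = Z at *
  have hpow := pow_ne_zero (2 * m) hz1
  generalize (1 - z) ^ (2 * m) = Y at *
  field_simp
  linear_combination (-Z * S ^ 2 * W * T ^ 2 * (1 + z)) * hm - Z * S ^ 2 * (1 + z) ^ (m + 1) * Δ * hden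

end Moments

theorem one_add_q_pow_ne_zero (k : ℕ) : 1 + q ^ k ≠ 0 := by
  have h : (1 + Polynomial.X ^ k : Polynomial ℚ) ≠ 0 := fun h => by
    have := congrArg (Polynomial.eval 1) h
    norm_num at this
  have := (map_ne_zero_iff _ (RatFunc.algebraMap_injective ℚ)).2 h
  simpa [q] using this

theorem one_sub_q_ne_zero : 1 - q ≠ 0 := by
  have h : (1 - Polynomial.X : Polynomial ℚ) ≠ 0 := fun h => by
    have := congrArg (Polynomial.eval 0) h
    norm_num at this
  have := (map_ne_zero_iff _ (RatFunc.algebraMap_injective ℚ)).2 h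
  simpa [q] using this

theorem prod_one_add_even (k : ℕ) :
    ∏ i ∈ range (2 * (k + 1)), (1 + q ^ (i + 1)) =
      (1 + q) * (1 + q ^ 2) * (qPoch (q ^ 2) (-q ^ 3) k * qPoch (q ^ 2) (-q ^ 4) k) := by
  induction k with
  | zero => simp [qPoch, prod_range_succ]
  | succ k ih =>
    rw [show 2 * (k + 1 + 1) = 2 * (k + 1) + 1 + 1 by ring, prod_range_succ, prod_range_succ, ih]
    simp only [qPoch, prod_range_succ]
    ring

theorem prod_one_add_odd (k : ℕ) :
    ∏ i ∈ range (2 * (k + 1) + 1), (1 + q ^ (i + 1)) =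
      (1 + q) * (1 + q ^ 2) * (1 + q ^ 3) *
        (qPoch (q ^ 2) (-q ^ 4) k * qPoch (q ^ 2) (-q ^ 5) k) := by
  induction k with
  | zero => simp [qPoch, prod_range_succ]
  | succ k ih =>
    rw [show 2 * (k + 1 + 1) + 1 = 2 * (k + 1) + 1 + 1 + 1 by ring, prod_range_succ,
      prod_range_succ, ih]
    simp only [qPoch, prod_range_succ]
    ring

theorem prod_one_sub_mul_prod_one_add (k : ℕ) :
    (∏ i ∈ range (k + 1), (1 - q ^ (i + 1))) * ∏ i ∈ range (k + 1), (1 + q ^ (i + 1)) =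
      (1 - q) * (1 + q) * qPoch (q ^ 2) (q ^ 4) k := by
  induction k with
  | zero => simp [qPoch]
  | succ k ih =>
    rw [prod_range_succ, prod_range_succ _ (k + 1), mul_mul_mul_comm, ih]
    simp only [qPoch, prod_range_succ]
    ring

theorem qPoch_neg_ne_zero (a k : ℕ) : qPoch (q ^ 2) (-q ^ a) k ≠ 0 := by
  refine prod_ne_zero_iff.2 fun j _ => ?_
  have h := one_add_q_pow_ne_zero (a + 2 * j)
  rwa [pow_add, pow_mul, ← sub_neg_eq_add, ← neg_mul] at h

/-- The numbers `C(2m+2, 3) / 4` are the sums of the first `m` squares. -/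
theorem choose_three_div_four_succ (m : ℕ) :
    (2 * (m + 1) + 2).choose 3 / 4 = (2 * m + 2).choose 3 / 4 + (m + 1) ^ 2 := by
  have h : (2 * (m + 1) + 2).choose 3 = (2 * m + 2).choose 3 + 4 * (m + 1) ^ 2 := by
    have h₁ : (2 * m + 3).choose 2 = (2 * m + 3) * (m + 1) := by
      rw [Nat.choose_two_right, show (2 * m + 3) * (2 * m + 3 - 1) = (2 * m + 3) * (m + 1) * 2 by
        rw [show 2 * m + 3 - 1 = (m + 1) * 2 by omega, mul_assoc]]
      simp
    have h₂ : (2 * m + 2).choose 2 = (2 * m + 1) * (m + 1) := by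
      rw [Nat.choose_two_right, show (2 * m + 2) * (2 * m + 2 - 1) = (2 * m + 1) * (m + 1) * 2 by
        rw [show 2 * m + 2 - 1 = 2 * m + 1 by omega]; ring]
      simp
    rw [show 2 * (m + 1) + 2 = 2 * m + 3 + 1 by ring, Nat.choose_succ_succ' (2 * m + 3) 2, h₁,
      Nat.choose_succ_succ' (2 * m + 2) 2, h₂]
    ring
  omega

/-- The product formula for the unshifted Hankel determinant. -/
theorem det_hankel_qEuler (ε : ℕ → RatFunc ℚ) (hε0 : ε 0 = 1)
    (hεrec : ∀ n : ℕ, 1 ≤ n →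
      (∑ k ∈ Finset.range (n + 1), (n.choose k : RatFunc ℚ) * q ^ (k + 1) * ε k) + ε n = 0)
    (n : ℕ) :
    Matrix.det (Matrix.of fun i j : Fin (n + 2) => ε ((i : ℕ) + (j : ℕ))) =
      (-1) ^ ((n + 2).choose 2) * q ^ ((2 * n + 4).choose 3 / 4) * (1 + q) ^ (n + 1) /
          ((1 - q) ^ (n * (n + 1)) * (1 + q ^ 2) ^ (2 * (n + 1)) * (1 + q ^ 3) ^ (n + 1)) *
        ∏ k ∈ Finset.Icc 1 n,
          qPoch (q ^ 2) (q ^ 4) k * qPoch (q ^ 2) (q ^ 4) k /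
            (qPoch (q ^ 2) (-q ^ 3) k * qPoch (q ^ 2) (-q ^ 4) k * qPoch (q ^ 2) (-q ^ 4) k *
              qPoch (q ^ 2) (-q ^ 5) k) := by
  have hq : 1 + q ≠ 0 := by simpa using one_add_q_pow_ne_zero 1
  have hq2 := one_add_q_pow_ne_zero 2
  have hq3 := one_add_q_pow_ne_zero 3
  have hq1 := one_sub_q_ne_zero
  have hratio (k : ℕ) := det_hankel_succ q one_add_q_pow_ne_zero hq1 ε hε0 hεrec (k + 1)
  simp only [prod_one_add_even, prod_one_add_odd, prod_one_sub_mul_prod_one_add] at hratio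
  induction n with
  | zero =>
    rw [hratio 0]
    simp [qPoch, hε0]
    field_simp
    ring
  | succ n ih =>
    have h3 := qPoch_neg_ne_zero 3 (n + 1)
    have h4 := qPoch_neg_ne_zero 4 (n + 1)
    have h5 := qPoch_neg_ne_zero 5 (n + 1)
    rw [hratio (n + 1), ih, prod_Icc_succ_top (by omega),
      show 2 * (n + 1) + 4 = 2 * (n + 1 + 1) + 2 by ring, choose_three_div_four_succ,
      show 2 * n + 4 = 2 * (n + 1) + 2 by ring, Nat.choose_succ_succ' (n + 2) 1,
      Nat.choose_one_right]
    generalize (2 * (n + 1) + 2).choose 3 / 4 = e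
    generalize (n + 2).choose (1 + 1) = c
    field_simp
    ring

theorem hankel_qEuler_shift_two (ε : ℕ → RatFunc ℚ) (hε0 : ε 0 = 1)
    (hεrec : ∀ n : ℕ, 1 ≤ n →
      (∑ k ∈ Finset.range (n + 1), (n.choose k : RatFunc ℚ) * q ^ (k + 1) * ε k) + ε n = 0) :
    ∀ n : ℕ,
      Matrix.det (Matrix.of fun i j : Fin (n + 1) => ε ((i : ℕ) + (j : ℕ) + 2)) =
        (-1) ^ ((n + 2).choose 2) * q ^ ((2 * n + 4).choose 3 / 4) * (1 + q) ^ n *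
            (1 - (-1) ^ n * q ^ ((n + 2) ^ 2)) /
            ((1 - q) ^ (n * (n + 1)) * (1 + q ^ 2) ^ (2 * (n + 1)) * (1 + q ^ 3) ^ (n + 1)) *
          ∏ k ∈ Finset.Icc 1 n,
            qPoch (q ^ 2) (q ^ 4) k * qPoch (q ^ 2) (q ^ 4) k /
              (qPoch (q ^ 2) (-q ^ 3) k * qPoch (q ^ 2) (-q ^ 4) k * qPoch (q ^ 2) (-q ^ 4) k *
                qPoch (q ^ 2) (-q ^ 5) k) := by
  intro n
  have hq : 1 + q ≠ 0 := by simpa using one_add_q_pow_ne_zero 1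
  apply mul_left_cancel₀ hq
  rw [det_hankel_shift_two q one_add_q_pow_ne_zero one_sub_q_ne_zero ε hε0 hεrec (n + 1),
    det_hankel_qEuler ε hε0 hεrec n]
  ring
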